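/- Let T : ℝ → ℕ → ℝ be real tetration, defined recursively by T x 1 = x and T x (n+1) = x ^ (T x n). For every real number c with c > 1 and every natural number n ≥ 1, there exists a unique real number x with x ≥ 1 such that T x n = c; moreover this unique root satisfies 1 ≤ x ≤ c. -/

import Mathlib

/-- For real tetration `T` (with `T x 1 = x`, `T x (n+1) = x ^ T x n`), every
`c > 1` and height `n ≥ 1` admit a unique real `x ≥ 1` with `T x n = c`; this
root moreover satisfies `x ≤ c`. -/
theorem tetration_root_exists_unique (T : ℝ → ℕ → ℝ)
    (hT1 : ∀ x : ℝ, T x 1 = x)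
    (hTs : ∀ x : ℝ, ∀ n : ℕ, 1 ≤ n → T x (n + 1) = x ^ T x n)
    (c : ℝ) (hc : 1 < c) (n : ℕ) (hn : 1 ≤ n) :
    (∃! x : ℝ, 1 ≤ x ∧ T x n = c) ∧
    (∀ x : ℝ, 1 ≤ x → T x n = c → x ≤ c) := by
  have key : T 1 n = 1 ∧ (∀ x : ℝ, 1 ≤ x → x ≤ T x n) ∧
      StrictMonoOn (fun x => T x n) (Set.Ici 1) ∧
      ContinuousOn (fun x => T x n) (Set.Ici 1) := by
    induction n, hn using Nat.le_induction with
    | base =>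
      simp only [hT1]
      exact ⟨trivial, fun x _ => le_refl x, fun x _ y _ h => h, continuousOn_id⟩
    | succ m hm ih =>
      obtain ⟨h1, h2, h3, h4⟩ := ih
      simp only [hTs _ m hm]
      refine ⟨Real.one_rpow _, fun x hx => ?_, fun x hx y hy hxy => ?_, ?_⟩
      · exact Real.self_le_rpow_of_one_le hx (hx.trans (h2 x hx))
      · have hx' : (1 : ℝ) ≤ x := hx
        have hxT := h2 x hx'
        calc x ^ T x m < y ^ T x m :=
              Real.rpow_lt_rpow (by linarith) hxy (by linarith)
          _ ≤ y ^ T y m :=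
              Real.rpow_le_rpow_of_exponent_le hy (h3 hx hy hxy).le
      · refine ContinuousOn.rpow continuousOn_id h4 fun x hx => Or.inl ?_
        have hx' : (1 : ℝ) ≤ x := hx
        exact (zero_lt_one.trans_le hx).ne.symm
  obtain ⟨h1, h2, h3, h4⟩ := key
  refine ⟨?_, fun x hx h => h ▸ h2 x hx⟩
  obtain ⟨x, hx, hxc⟩ := intermediate_value_Icc hc.le
    (h4.mono Set.Icc_subset_Ici_self) ⟨h1.le.trans hc.le, h2 c hc.le⟩
  refine ⟨x, ⟨hx.1, hxc⟩, fun y hy => h3.injOn hy.1 hx.1 (hy.2.trans hxc.symm)⟩
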